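/- For any HMS model M with L-transform L(M) and state correspondence ℓ, for all formulas φ of the language L, for all states w ∈ Ω_M, and for all worlds v ∈ ℓ(w): M, w ⊨ φ if and only if L(M), v ⊩ φ. -/

import Mathlib

/-- Upwards closure `D↑` of a set `D` of states (assumed contained in a single
state-space): `w ∈ D↑` iff some `s ∈ D` lives in a space below `w`'s and `w`
projects onto `s`. -/
def upcl {σ Ω : Type} [CompleteLattice σ] (space : Ω → σ) (proj : Ω → σ → Ω)
    (D : Set Ω) : Set Ω :=
  {w | ∃ s ∈ D, space s ≤ space w ∧ proj w (space s) = s}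

/-- An HMS model: an unawareness frame (a complete lattice `σ` of state-spaces,
each state `w : Ω` lying in the space `space w`; surjective, commuting projections
`proj`; possibility correspondences `Pos` satisfying Confinement, Generalized
Reflexivity, Stationarity, Projections Preserve Ignorance and Projections Preserve
Knowledge) together with an HMS valuation: each atom `p` is assigned the event
`(Vbase p)↑` based in the state-space `Vsp p`. -/
structure HMSModel (Ag At σ Ω : Type) [CompleteLattice σ] where
  nonemptyΩ : Nonempty Ω
  space : Ω → σ
  space_surj : Function.Surjective space
  proj : Ω → σ → Ω
  proj_space : ∀ w S, S ≤ space w → space (proj w S) = S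
  proj_id : ∀ w, proj w (space w) = w
  proj_comm : ∀ w S S', S ≤ S' → S' ≤ space w → proj (proj w S') S = proj w S
  proj_surj : ∀ (s : Ω) (S' : σ), space s ≤ S' → ∃ w, space w = S' ∧ proj w (space s) = s
  Pos : Ag → Ω → Set Ω
  conf : ∀ a w, ∃ S, S ≤ space w ∧ ∀ s ∈ Pos a w, space s = S
  gref : ∀ a w, w ∈ upcl space proj (Pos a w)
  stat : ∀ a w w', w' ∈ Pos a w → Pos a w' = Pos a w
  ppi : ∀ a w S, S ≤ space w →
    upcl space proj (Pos a w) ⊆ upcl space proj (Pos a (proj w S))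
  ppk : ∀ a w S S', S ≤ S' → S' ≤ space w → (∀ s ∈ Pos a w, space s = S') →
    (fun s => proj s S) '' Pos a w = Pos a (proj w S)
  Vbase : At → Set Ω
  Vsp : At → σ
  Vbase_sub : ∀ p, ∀ s ∈ Vbase p, space s = Vsp p

namespace HMSModel

variable {Ag At σ Ω : Type} [CompleteLattice σ]

/-- The event `V_M(p)`, as a set of states: the upwards closure of its base. -/
def Vset (M : HMSModel Ag At σ Ω) (p : At) : Set Ω :=
  upcl M.space M.proj (M.Vbase p)

/-- The event negation `¬V_M(p) = ((S \ D)↑, S)`, as a set of states. -/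
def negVset (M : HMSModel Ag At σ Ω) (p : At) : Set Ω :=
  upcl M.space M.proj ({s | M.space s = M.Vsp p} \ M.Vbase p)

/-- `At(O)`: the atoms that have a defined truth value throughout `O`. -/
def AtO (M : HMSModel Ag At σ Ω) (O : Set Ω) : Set At :=
  {p | O ⊆ M.Vset p ∪ M.negVset p}

/-- `At(S)` for a state-space `S`: the atoms defined throughout `S`. -/
def AtS (M : HMSModel Ag At σ Ω) (S : σ) : Set At :=
  M.AtO {s | M.space s = S}

/-- The maximal state-space `T`; it is the set of worlds `W` of the Kripke model
underlying the `L`-transform of `M`. -/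
abbrev T (M : HMSModel Ag At σ Ω) : Type := {s : Ω // M.space s = ⊤}

/-- The accessibility relation of the `L`-transform of `M`:
`(w, v) ∈ R_a` iff `r^T_{S(Π_a(w))}(v) ∈ Π_a(w)`, where `S(Π_a(w))` is the
state-space containing `Π_a(w)`.  The information cell of `a` at the world
`w_X = (w, X)` of the restriction `K_X` is `I_a(w_X) = {(v, X) : LR a w v}`. -/
def LR (M : HMSModel Ag At σ Ω) (a : Ag) (w v : M.T) : Prop :=
  ∃ S : σ, (∀ s ∈ M.Pos a w.1, M.space s = S) ∧ M.proj v.1 S ∈ M.Pos a w.1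

/-- Defining property of the awareness maps of the `L`-transform of `M`:
`π_a(w_X) = (w, At(S_Y))` where `S_Y` is the state-space with
`S_Y ⊇ Π_a(r^T_{S_X}(w))` and `S_X = min {S : At(S) = X}`. -/
def LpiSpec (M : HMSModel Ag At σ Ω)
    (π : Ag → M.T × Set At → M.T × Set At) : Prop :=
  ∀ (a : Ag) (w : M.T) (X : Set At), ∃ SX SY : σ,
    IsLeast {S : σ | M.AtS S = X} SX ∧
    (M.Pos a (M.proj w.1 SX)).Nonempty ∧
    (∀ s ∈ M.Pos a (M.proj w.1 SX), M.space s = SY) ∧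
    π a (w, X) = (w, M.AtS SY)

end HMSModel

/-- A Kripke model for a set of atoms: a nonempty type of worlds `W`, accessibility
relations `R a` for each agent `a`, and a valuation `V`. -/
structure KripkeModel (Ag At W : Type) where
  nonempty : Nonempty W
  R : Ag → W → W → Prop
  V : At → Set W

/-- Awareness-map properties (D) Downwards, (II) Introspective Idempotence and
(NS) No Surprises, over the restriction lattice of `K`.  Worlds of the restriction
`K_X` are encoded as pairs `w_X = (w, X)`; the information cell of `a` at `w_X` is
`I_a(w_X) = {(v, X) : K.R a w v}`. -/
def IsAwarenessMap {Ag At W : Type} (K : KripkeModel Ag At W)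
    (π : Ag → W × Set At → W × Set At) : Prop :=
  (∀ (a : Ag) (w : W) (X : Set At), ∃ Y : Set At, Y ⊆ X ∧ π a (w, X) = (w, Y)) ∧
  (∀ (a : Ag) (w : W) (X Y : Set At), π a (w, X) = (w, Y) →
    ∀ v : W, K.R a w v → ∃ u : W, K.R a w u ∧ π a (v, Y) = (u, Y)) ∧
  (∀ (a : Ag) (w : W) (X Z : Set At), π a (w, X) = (w, Z) →
    ∀ Y : Set At, Y ⊆ X → π a (w, Y) = (w, Y ∩ Z))

/-- The language `L` of knowledge: `φ ::= ⊤ | p | ¬φ | φ ∧ φ | K_a φ`. -/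
inductive Form (Ag At : Type) : Type
  | top : Form Ag At
  | atom : At → Form Ag At
  | neg : Form Ag At → Form Ag At
  | conj : Form Ag At → Form Ag At → Form Ag At
  | know : Ag → Form Ag At → Form Ag At

/-- `At(φ)`: the set of atoms occurring in `φ`. -/
def Form.atoms {Ag At : Type} : Form Ag At → Set At
  | .top => ∅
  | .atom p => {p}
  | .neg φ => φ.atoms
  | .conj φ ψ => φ.atoms ∪ ψ.atoms
  | .know _ φ => φ.atoms

/-- Three-valued satisfaction `K, w_X ⊩ φ` over a Kripke lattice model, given by
its base Kripke model `K` and awareness maps `π`.  Worlds of the restriction `K_X`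
are pairs `(w, X)`; `(w_X, v_X) ∈ R_{Xa}` iff `(w, v) ∈ R_a`, and `w_X ∈ V_X(p)`
iff `p ∈ X` and `w ∈ V(p)`. -/
def ksat {Ag At W : Type} (K : KripkeModel Ag At W)
    (π : Ag → W × Set At → W × Set At) : Form Ag At → W × Set At → Prop
  | .top, _ => True
  | .atom p, q => p ∈ q.2 ∧ q.1 ∈ K.V p
  | .neg φ, q => φ.atoms ⊆ q.2 ∧ ¬ ksat K π φ q
  | .conj φ ψ, q => (Form.conj φ ψ).atoms ⊆ q.2 ∧ ksat K π φ q ∧ ksat K π ψ q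
  | .know a φ, q => φ.atoms ⊆ q.2 ∧
      ∀ v : W, K.R a (π a q).1 v → ksat K π φ (v, (π a q).2)

/-- HMS satisfaction `M, w ⊨ φ` over an HMS model `M`: an atom `p` is true at `w`
iff `w ∈ V_M(p)`; `¬φ` holds at `w` iff `w ∈ ¬[[φ]]`, i.e. iff every atom of `φ`
has a defined truth value at `w` and `φ` fails at `w`; `φ ∧ ψ` holds iff
`w ∈ [[φ]] ∩ [[ψ]]`; `K_a φ` holds iff `w` is in the knowledge event
`K_a([[φ]])`, i.e. iff `Π_a(w) ⊆ [[φ]]`. -/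
def msat {Ag At σ Ω : Type} [CompleteLattice σ] (M : HMSModel Ag At σ Ω) :
    Form Ag At → Ω → Prop
  | .top, _ => True
  | .atom p, w => w ∈ M.Vset p
  | .neg φ, w => (∀ p ∈ φ.atoms, w ∈ M.Vset p ∪ M.negVset p) ∧ ¬ msat M φ w
  | .conj φ ψ, w => msat M φ w ∧ msat M ψ w
  | .know a φ, w => ∀ v ∈ M.Pos a w, msat M φ v

/-- The Kripke model `K = (W, R, V)` underlying the `L`-transform of `M`:
`W = T`, `R_a = LR a`, and `w ∈ V(p)` iff `w ∈ V_M(p)`. -/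
def LKripke {Ag At σ Ω : Type} [CompleteLattice σ] (M : HMSModel Ag At σ Ω) :
    KripkeModel Ag At M.T where
  nonempty := ⟨⟨(M.space_surj ⊤).choose, (M.space_surj ⊤).choose_spec⟩⟩
  R := M.LR
  V p := {w : M.T | w.1 ∈ M.Vset p}

namespace HMSModel

variable {Ag At σ Ω : Type} [CompleteLattice σ]

theorem mem_Vset_iff (M : HMSModel Ag At σ Ω) (p : At) (w : Ω) :
    w ∈ M.Vset p ↔ M.Vsp p ≤ M.space w ∧ M.proj w (M.Vsp p) ∈ M.Vbase p := by
  constructor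
  · rintro ⟨s, hs, hle, he⟩
    rw [M.Vbase_sub p s hs] at hle he
    exact ⟨hle, he ▸ hs⟩
  · rintro ⟨hle, hm⟩
    have h := M.proj_space w _ hle
    exact ⟨_, hm, by rwa [h], by rw [h]⟩

theorem mem_negVset_iff (M : HMSModel Ag At σ Ω) (p : At) (w : Ω) :
    w ∈ M.negVset p ↔ M.Vsp p ≤ M.space w ∧ M.proj w (M.Vsp p) ∉ M.Vbase p := by
  constructor
  · rintro ⟨s, ⟨hs, hn⟩, hle, he⟩
    rw [show M.space s = M.Vsp p from hs] at hle he
    exact ⟨hle, he ▸ hn⟩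
  · rintro ⟨hle, hm⟩
    have h := M.proj_space w _ hle
    exact ⟨_, ⟨h, hm⟩, by rwa [h], by rw [h]⟩

theorem mem_Vset_union_negVset_iff (M : HMSModel Ag At σ Ω) (p : At) (w : Ω) :
    w ∈ M.Vset p ∪ M.negVset p ↔ M.Vsp p ≤ M.space w := by
  rw [Set.mem_union, mem_Vset_iff, mem_negVset_iff]
  tauto

theorem mem_AtS_iff (M : HMSModel Ag At σ Ω) (p : At) (S : σ) :
    p ∈ M.AtS S ↔ M.Vsp p ≤ S := by
  constructor
  · intro h
    obtain ⟨w, rfl⟩ := M.space_surj S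
    exact (M.mem_Vset_union_negVset_iff p w).1 (h rfl)
  · rintro h w rfl
    exact (M.mem_Vset_union_negVset_iff p w).2 h

theorem Pos_nonempty (M : HMSModel Ag At σ Ω) (a : Ag) (w : Ω) : (M.Pos a w).Nonempty := by
  obtain ⟨s, hs, -⟩ := M.gref a w
  exact ⟨s, hs⟩

/-- Projections preserve ignorance: the information of a projected state lives in a
lower space. -/
theorem Pos_proj_space_le (M : HMSModel Ag At σ Ω) {a : Ag} {w : Ω} {S S₀ S₁ : σ}
    (hS : S ≤ M.space w) (h₀ : ∀ s ∈ M.Pos a w, M.space s = S₀)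
    (h₁ : ∀ s ∈ M.Pos a (M.proj w S), M.space s = S₁) : S₁ ≤ S₀ := by
  obtain ⟨u, hu⟩ := M.Pos_nonempty a w
  obtain ⟨t, ht, hle, -⟩ := M.ppi a w S hS ⟨u, hu, le_rfl, M.proj_id u⟩
  rwa [h₁ t ht, h₀ u hu] at hle

/-- Projecting a state to `S` moves the space of its information to the meet with `S`. -/
theorem Pos_proj_space_eq (M : HMSModel Ag At σ Ω) {a : Ag} {w : Ω} {S S₀ S₁ : σ}
    (hS : S ≤ M.space w) (h₀ : ∀ s ∈ M.Pos a w, M.space s = S₀) (hS₀ : S₀ ≤ M.space w)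
    (h₁ : ∀ s ∈ M.Pos a (M.proj w S), M.space s = S₁) : S₁ = S₀ ⊓ S := by
  apply le_antisymm
  · refine le_inf (M.Pos_proj_space_le hS h₀ h₁) ?_
    obtain ⟨S', hle, hS'⟩ := M.conf a (M.proj w S)
    obtain ⟨u, hu⟩ := M.Pos_nonempty a (M.proj w S)
    rw [M.proj_space w S hS] at hle
    rwa [← h₁ u hu, hS' u hu]
  · have hU : ∀ s ∈ M.Pos a (M.proj (M.proj w S) (S₀ ⊓ S)), M.space s = S₀ ⊓ S := by
      rw [M.proj_comm w _ _ inf_le_right hS, ← M.ppk a w _ _ inf_le_left hS₀ h₀]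
      rintro _ ⟨u, hu, rfl⟩
      exact M.proj_space u _ (by rw [h₀ u hu]; exact inf_le_left)
    exact M.Pos_proj_space_le (by rw [M.proj_space w S hS]; exact inf_le_right) h₁ hU

/-- The information of a projected state is the projection of the information. -/
theorem image_Pos_eq_Pos_proj (M : HMSModel Ag At σ Ω) {a : Ag} {w : Ω} {S S₀ S₁ : σ}
    (hS : S ≤ M.space w) (h₀ : ∀ s ∈ M.Pos a w, M.space s = S₀) (hS₀ : S₀ ≤ M.space w)
    (h₁ : ∀ s ∈ M.Pos a (M.proj w S), M.space s = S₁) :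
    (fun s => M.proj s S₁) '' M.Pos a w = M.Pos a (M.proj w S) := by
  have h := M.Pos_proj_space_eq hS h₀ hS₀ h₁
  have hS₁ : S₁ ≤ S := h ▸ inf_le_right
  rw [M.ppk a w S₁ S₀ (h ▸ inf_le_left) hS₀ h₀, ← M.proj_comm w S₁ S hS₁ hS,
    ← M.ppk a (M.proj w S) S₁ S₁ le_rfl (by rwa [M.proj_space w S hS]) h₁]
  have hid : ∀ s ∈ M.Pos a (M.proj w S), M.proj s S₁ = s := fun s hs => by
    rw [← h₁ s hs, M.proj_id]
  exact (Set.image_congr hid).trans (Set.image_id' _)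

/-- The information of the projection of a maximal state `v` to `S` consists of the
projections of the worlds accessible from `v`. -/
theorem mem_Pos_proj_iff_exists_LR (M : HMSModel Ag At σ Ω) {a : Ag} {v : M.T} {S S₁ : σ}
    (h₁ : ∀ s ∈ M.Pos a (M.proj v.1 S), M.space s = S₁) (t : Ω) :
    t ∈ M.Pos a (M.proj v.1 S) ↔ ∃ u : M.T, M.LR a v u ∧ M.proj u.1 S₁ = t := by
  have htop : ∀ (u : M.T) (S' : σ), S' ≤ M.space u.1 := fun u S' => u.2.symm ▸ le_top
  obtain ⟨S₀, hS₀, h₀⟩ := M.conf a v.1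
  have hle : S₁ ≤ S₀ := M.Pos_proj_space_le (htop v S) h₀ h₁
  rw [← M.image_Pos_eq_Pos_proj (htop v S) h₀ hS₀ h₁]
  constructor
  · rintro ⟨x, hx, rfl⟩
    obtain ⟨u, hu, hux⟩ := M.proj_surj x ⊤ le_top
    rw [h₀ x hx] at hux
    refine ⟨⟨u, hu⟩, ⟨S₀, h₀, by rwa [hux]⟩, ?_⟩
    rw [← hux]
    exact (M.proj_comm u _ _ hle (htop ⟨u, hu⟩ _)).symm
  · rintro ⟨u, ⟨S', hS', hu⟩, rfl⟩
    obtain rfl : S' = S₀ := by rw [← hS' _ hu, h₀ _ hu]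
    exact ⟨_, hu, M.proj_comm u.1 _ _ hle (htop u _)⟩

/-- A formula that holds at a state has only atoms defined at the space of that state. -/
theorem atoms_subset_AtS_of_msat (M : HMSModel Ag At σ Ω) (φ : Form Ag At) :
    ∀ w, msat M φ w → φ.atoms ⊆ M.AtS (M.space w) := by
  induction φ with
  | top => exact fun _ _ => Set.empty_subset _
  | atom p =>
    rintro w h _ rfl
    exact (M.mem_AtS_iff _ _).2 ((M.mem_Vset_iff _ _).1 h).1
  | neg φ _ =>
    intro w h p hp
    exact (M.mem_AtS_iff _ _).2 ((M.mem_Vset_union_negVset_iff _ _).1 (h.1 p hp))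
  | conj φ ψ ihφ ihψ => exact fun w h => Set.union_subset (ihφ w h.1) (ihψ w h.2)
  | know a φ ih =>
    intro w h p hp
    obtain ⟨u, hu⟩ := M.Pos_nonempty a w
    obtain ⟨S, hS, hS'⟩ := M.conf a w
    have := (M.mem_AtS_iff _ _).1 (ih u (h u hu) hp)
    rw [hS' u hu] at this
    exact (M.mem_AtS_iff _ _).2 (this.trans hS)

/-- At the world `(v, At(S))`, the awareness map returns the atoms defined at the space of
the information that the agent has at the projection of `v` to `S`. -/
theorem LpiSpec.apply_AtS {M : HMSModel Ag At σ Ω} {π : Ag → M.T × Set At → M.T × Set At}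
    (hπ : M.LpiSpec π) {a : Ag} {v : M.T} {S S₁ : σ} (hS₁ : S₁ ≤ S)
    (h₁ : ∀ s ∈ M.Pos a (M.proj v.1 S), M.space s = S₁) :
    π a (v, M.AtS S) = (v, M.AtS S₁) := by
  obtain ⟨SX, SY, ⟨hX, hmin⟩, -, hSY, heq⟩ := hπ a v (M.AtS S)
  have hSv : S ≤ M.space v.1 := v.2.symm ▸ le_top
  have hSX : SX ≤ S := hmin rfl
  have hsp := M.proj_space v.1 S hSv
  rw [← M.proj_comm v.1 SX S hSX hSv] at hSY
  obtain rfl := M.Pos_proj_space_eq (by rwa [hsp]) h₁ (by rwa [hsp]) hSY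
  rw [heq]
  congr 1
  ext p
  have hp : p ∈ M.AtS SX ↔ p ∈ M.AtS S := by rw [show M.AtS SX = M.AtS S from hX]
  simp only [mem_AtS_iff, le_inf_iff] at hp ⊢
  exact ⟨fun h => h.1, fun h => ⟨h, hp.2 (h.trans hS₁)⟩⟩

end HMSModel

/-- For any HMS model `M` with `L`-transform `L(M)` and state
correspondence `ℓ`, for all formulas `φ` of `L`, all states `s ∈ Ω_M`, and all
worlds `v_X ∈ ℓ(s)` (i.e. `v ∈ (r^T_{S(s)})⁻¹(s)` and `X = At(S(s))`):
`M, s ⊨ φ` iff `L(M), v_X ⊩ φ`. -/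
theorem Ltransform_preserves_satisfaction
    (Ag At σ Ω : Type) [CompleteLattice σ]
    [Finite Ag] [Nonempty Ag] [Countable At] [Nonempty At]
    (M : HMSModel Ag At σ Ω) (π : Ag → M.T × Set At → M.T × Set At)
    (hπ : M.LpiSpec π) :
    ∀ (φ : Form Ag At) (s : Ω) (v : M.T) (X : Set At),
      M.proj v.1 (M.space s) = s → X = M.AtS (M.space s) →
      (msat M φ s ↔ ksat (LKripke M) π φ (v, X)) := by
  intro φ
  induction φ with
  | top => exact fun _ _ _ _ _ => Iff.rfl
  | atom p =>
    rintro s v X hs rfl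
    have hsv : M.space s ≤ M.space v.1 := v.2.symm ▸ le_top
    change s ∈ M.Vset p ↔ p ∈ M.AtS (M.space s) ∧ v.1 ∈ M.Vset p
    rw [M.mem_Vset_iff, M.mem_Vset_iff, M.mem_AtS_iff]
    have key : M.Vsp p ≤ M.space s → M.proj s (M.Vsp p) = M.proj v.1 (M.Vsp p) := fun h => by
      rw [← M.proj_comm v.1 _ _ h hsv, hs]
    constructor
    · rintro ⟨h, hm⟩
      exact ⟨h, h.trans hsv, key h ▸ hm⟩
    · rintro ⟨h, -, hm⟩
      exact ⟨h, (key h).symm ▸ hm⟩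
  | neg φ ih =>
    rintro s v X hs rfl
    refine and_congr (forall₂_congr fun p _ => ?_) (not_congr (ih s v _ hs rfl))
    rw [M.mem_Vset_union_negVset_iff]
    exact (M.mem_AtS_iff _ _).symm
  | conj φ ψ ihφ ihψ =>
    rintro s v X hs rfl
    have h : msat M (.conj φ ψ) s ↔ ksat (LKripke M) π φ (v, M.AtS (M.space s)) ∧
        ksat (LKripke M) π ψ (v, M.AtS (M.space s)) :=
      and_congr (ihφ s v _ hs rfl) (ihψ s v _ hs rfl)
    exact ⟨fun hm => ⟨M.atoms_subset_AtS_of_msat _ _ hm, h.1 hm⟩, fun hk => h.2 hk.2⟩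
  | know a φ ih =>
    rintro s v X hs rfl
    obtain ⟨S₁, hS₁, h₁⟩ := M.conf a s
    have h₁' : ∀ t ∈ M.Pos a (M.proj v.1 (M.space s)), M.space t = S₁ := by rwa [hs]
    have hmem := M.mem_Pos_proj_iff_exists_LR h₁'
    rw [hs] at hmem
    have hsat : ∀ u : M.T, msat M φ (M.proj u.1 S₁) ↔
        ksat (LKripke M) π φ (u, M.AtS S₁) := fun u => by
      have hu := M.proj_space u.1 S₁ (u.2.symm ▸ le_top)
      exact ih _ u _ (by rw [hu]) (by rw [hu])
    have h : msat M (.know a φ) s ↔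
        ∀ u : M.T, M.LR a v u → ksat (LKripke M) π φ (u, M.AtS S₁) := by
      constructor
      · exact fun hm u hu => (hsat u).1 (hm _ ((hmem _).2 ⟨u, hu, rfl⟩))
      · intro hk t ht
        obtain ⟨u, hu, rfl⟩ := (hmem t).1 ht
        exact (hsat u).2 (hk u hu)
    have hk : ksat (LKripke M) π (.know a φ) (v, M.AtS (M.space s)) ↔
        φ.atoms ⊆ M.AtS (M.space s) ∧
          ∀ u : M.T, M.LR a v u → ksat (LKripke M) π φ (u, M.AtS S₁) := by
      rw [ksat, hπ.apply_AtS hS₁ h₁']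
      rfl
    rw [hk]
    exact ⟨fun hm => ⟨M.atoms_subset_AtS_of_msat (.know a φ) _ hm, h.1 hm⟩, fun hk => h.2 hk.2⟩
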